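/- arXiv:2012.03779 — 5 statements merged into one kernel-verified Lean document; each statement's English description precedes it below -/
import Mathlib

section
/- Let 𝒜 be an abelian category, 𝒳 an extension-closed full subcategory, and 𝒲 ⊆ 𝒳 with Extⁱ(W, X) = 0 for all W ∈ 𝒲, X ∈ 𝒳, i ≥ 1, and such that 𝒲 is a generator for 𝒳. If C has finite 𝒳-coresolution dimension at most n (a finite coresolution by objects of 𝒳 of length n), then there exists a short exact sequence 0 → C → X^C → Y^C → 0 with X^C ∈ 𝒳 and Y^C having a finite 𝒲-coresolution of length at most n−1; moreover the map C → X^C is a left 𝒳-approximation of C. -/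
open CategoryTheory CategoryTheory.Limits Opposite

universe v u

variable {A : Type u} [Category.{v} A] [Abelian A]

/-- `IsSES f g` : `0 → X → Y → Z → 0` is a short exact sequence. -/
def IsSES {X Y Z : A} (f : X ⟶ Y) (g : Y ⟶ Z) : Prop :=
  ∃ w : f ≫ g = 0, (ShortComplex.mk f g w).ShortExact

/-- `HasCoresLE S n C` : `C` admits a coresolution `0 → C → X₀ → ⋯ → X₋ₙ → 0`
with all terms in `S`. -/
def HasCoresLE (S : Set A) : ℕ → A → Prop
  | 0, C => C ∈ S
  | n+1, C => ∃ (X K : A) (f : C ⟶ X) (g : X ⟶ K), X ∈ S ∧ IsSES f g ∧ HasCoresLE S n K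

/-- `S` is closed under extensions. -/
def ExtClosed (S : Set A) : Prop :=
  ∀ ⦃X Y Z : A⦄ (f : X ⟶ Y) (g : Y ⟶ Z), IsSES f g → X ∈ S → Z ∈ S → Y ∈ S

/-- `S` is closed under cokernels of monomorphisms. -/
def CokerClosed (S : Set A) : Prop :=
  ∀ ⦃X Y Z : A⦄ (f : X ⟶ Y) (g : Y ⟶ Z), IsSES f g → X ∈ S → Y ∈ S → Z ∈ S

/-- `S` is closed under kernels of epimorphisms. -/
def KerClosed (S : Set A) : Prop :=
  ∀ ⦃X Y Z : A⦄ (f : X ⟶ Y) (g : Y ⟶ Z), IsSES f g → Y ∈ S → Z ∈ S → X ∈ S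

/-- `W` is a generator for `X` : every object of `X` receives an epimorphism from
an object of `W` with kernel in `X`. -/
def IsGen (W X : Set A) : Prop :=
  W ⊆ X ∧ ∀ C ∈ X, ∃ (X' W₀ : A) (f : X' ⟶ W₀) (g : W₀ ⟶ C),
    W₀ ∈ W ∧ X' ∈ X ∧ IsSES f g

/-- `Extⁱ(X, Y) = 0`. -/
def ExtVanish [EnoughProjectives A] (i : ℕ) (X Y : A) : Prop :=
  IsZero (((Ext ℤ A i).obj (op X)).obj Y)

/-- `W` is `X`-projective: `Extⁱ(W, X) = 0` for all `i ≥ 1`. -/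
def IsXProj [EnoughProjectives A] (W X : Set A) : Prop :=
  ∀ W' ∈ W, ∀ X' ∈ X, ∀ i : ℕ, 1 ≤ i → ExtVanish i W' X'

namespace Stmt2Aux

lemma isSES_of_lift {X Y Z : A} (f : X ⟶ Y) (g : Y ⟶ Z) (w : f ≫ g = 0) [Mono f] [Epi g]
    (h : ∀ {T : A} (k : T ⟶ Y), k ≫ g = 0 → ∃ l : T ⟶ X, l ≫ f = k) : IsSES f g := by
  refine ⟨w, ?_⟩
  have hex : (ShortComplex.mk f g w).Exact :=
    ShortComplex.exact_of_f_is_kernel _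
      (KernelFork.IsLimit.ofι' f w (fun k hk => ⟨(h k hk).choose, (h k hk).choose_spec⟩))
  exact { exact := hex, mono_f := ‹_›, epi_g := ‹_› }

lemma IsSES.lift {X Y Z : A} {f : X ⟶ Y} {g : Y ⟶ Z} (h : IsSES f g) {T : A} (k : T ⟶ Y)
    (hk : k ≫ g = 0) : ∃ l : T ⟶ X, l ≫ f = k := by
  obtain ⟨w, h⟩ := h
  have := h.mono_f
  exact ⟨h.exact.lift k hk, h.exact.lift_f k hk⟩

lemma IsSES.mono {X Y Z : A} {f : X ⟶ Y} {g : Y ⟶ Z} (h : IsSES f g) : Mono f := h.2.mono_f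

lemma IsSES.epi {X Y Z : A} {f : X ⟶ Y} {g : Y ⟶ Z} (h : IsSES f g) : Epi g := h.2.epi_g

/-- Pulling back a short exact sequence along a map to its third term. -/
lemma pull_ses {X Y Z P T : A} {f : X ⟶ Y} {g : Y ⟶ Z} (h : IsSES f g) {t : T ⟶ Z}
    {p : P ⟶ Y} {q : P ⟶ T} (sq : IsPullback p q g t) : ∃ i : X ⟶ P, IsSES i q := by
  have := IsSES.mono h
  have := IsSES.epi h
  obtain ⟨w, -⟩ := id h
  have hi1 : sq.lift f 0 (by simp [w]) ≫ p = f := sq.lift_fst _ _ _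
  have hi2 : sq.lift f 0 (by simp [w]) ≫ q = 0 := sq.lift_snd _ _ _
  generalize sq.lift f 0 (by simp [w]) = i at hi1 hi2
  have : Mono i := by
    have : Mono (i ≫ p) := by rw [hi1]; infer_instance
    exact mono_of_mono i p
  have : Epi q := by
    have e : q = sq.isoPullback.hom ≫ pullback.snd g t := by simp
    rw [e]; infer_instance
  refine ⟨i, isSES_of_lift i q hi2 fun k hk => ?_⟩
  obtain ⟨l, hl⟩ := IsSES.lift h (k ≫ p) (by rw [Category.assoc, sq.w, ← Category.assoc, hk, zero_comp])
  refine ⟨l, sq.hom_ext ?_ ?_⟩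
  · rw [Category.assoc, hi1, hl]
  · rw [Category.assoc, hi2, hk, comp_zero]

/-- Pulling back the first map of a short exact sequence along an epimorphism. -/
lemma pull_ses' {X Y Z P T : A} {f : X ⟶ Y} {g : Y ⟶ Z} (h : IsSES f g) {t : T ⟶ Y} [Epi t]
    {p : P ⟶ X} {q : P ⟶ T} (sq : IsPullback p q f t) : IsSES q (t ≫ g) := by
  have := IsSES.mono h
  have := IsSES.epi h
  obtain ⟨w, -⟩ := id h
  have : Mono q := sq.mono_snd_of_mono
  have : Epi (t ≫ g) := epi_comp _ _
  refine isSES_of_lift q _ (by rw [← Category.assoc, ← sq.w, Category.assoc, w, comp_zero])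
    fun k hk => ?_
  obtain ⟨l, hl⟩ := IsSES.lift h (k ≫ t) (by rw [Category.assoc, hk])
  exact ⟨sq.lift l k hl, sq.lift_snd _ _ _⟩

lemma step {S : Set A} (hX : ExtClosed S) {C X K X' Y : A} {f : C ⟶ X} {g : X ⟶ K}
    {f' : X' ⟶ Y} {g' : Y ⟶ K} (h : IsSES f g) (h' : IsSES f' g') (hx : X ∈ S) (hx' : X' ∈ S) :
    ∃ (P : A) (i : C ⟶ P) (q : P ⟶ Y), P ∈ S ∧ IsSES i q := by
  have sq := IsPullback.of_hasPullback g g'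
  obtain ⟨i, hi⟩ := pull_ses h sq
  obtain ⟨j, hj⟩ := pull_ses h' sq.flip
  exact ⟨_, i, _, hX _ _ hj hx' hx, hi⟩

lemma exists_precover {S W : Set A} (hX : ExtClosed S) (hgen : IsGen W S) :
    ∀ (n : ℕ) (K : A), HasCoresLE S n K →
      ∃ (X' Y : A) (f : X' ⟶ Y) (g : Y ⟶ K), X' ∈ S ∧ HasCoresLE W n Y ∧ IsSES f g := by
  intro n
  induction n with
  | zero =>
    intro K hK
    obtain ⟨X', W₀, f, g, hw, hx, h⟩ := hgen.2 K hK
    exact ⟨X', W₀, f, g, hx, hw, h⟩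
  | succ n ih =>
    rintro K ⟨X, K', f, g, hx, h, hK'⟩
    obtain ⟨X', Y, f', g', hx', hY, h'⟩ := ih K' hK'
    obtain ⟨P, i, q, hP, hiq⟩ := step hX h h' hx hx'
    obtain ⟨X'', W₀, a, b, hw, hx'', hab⟩ := hgen.2 P hP
    have := IsSES.epi hab
    have sq := IsPullback.of_hasPullback i b
    obtain ⟨j, hj⟩ := pull_ses hab sq.flip
    exact ⟨X'', _, j, _, hx'', ⟨W₀, Y, _, _, hw, pull_ses' hiq sq, hY⟩, hj⟩

lemma subsingleton_ext [EnoughProjectives A] [HasExt.{v} A] {i : ℕ} (hi : 1 ≤ i) {X Y : A}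
    (h : ExtVanish i X Y) (α : Abelian.Ext.{v} X Y i) : α = 0 := by
  obtain ⟨p, rfl⟩ : ∃ p, i = p + 1 := ⟨i - 1, by omega⟩
  let R := projectiveResolution X
  obtain ⟨f, hf, rfl⟩ := R.extMk_surjective α (p + 2) rfl
  rw [R.extMk_eq_zero_iff f (p + 2) rfl hf p rfl]
  have h1 : IsZero ((R.complex.linearYonedaObj ℤ Y).homology (p + 1)) :=
    IsZero.of_iso h (R.isoExt (p + 1) Y).symm
  rw [← HomologicalComplex.exactAt_iff_isZero_homology,
    HomologicalComplex.exactAt_iff' _ p (p + 1) (p + 2) (by simp) (by simp),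
    ShortComplex.moduleCat_exact_iff] at h1
  exact h1 f hf

lemma ext_cores [EnoughProjectives A] [HasExt.{v} A] {S W : Set A} (hproj : IsXProj W S)
    {X : A} (hx : X ∈ S) : ∀ (n : ℕ) (Y : A), HasCoresLE W n Y → ∀ (i : ℕ), 1 ≤ i →
      ∀ α : Abelian.Ext.{v} Y X i, α = 0 := by
  intro n
  induction n with
  | zero => intro Y hY i hi α; exact subsingleton_ext hi (hproj Y hY X hx i hi) α
  | succ n ih =>
    rintro Y ⟨W₀, K, f, g, hw, ⟨w, h⟩, hK⟩ i hi α
    obtain ⟨β, hβ⟩ := Abelian.Ext.contravariant_sequence_exact₁ h X α (n₁ := 1 + i) rfl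
      (ih K hK _ (by omega) _)
    rw [← hβ, subsingleton_ext hi (hproj W₀ hw X hx i hi) β]
    simp

lemma extend [HasExt.{v} A] {C P Y X : A} {f : C ⟶ P} {g : P ⟶ Y} (h : IsSES f g)
    (hY : ∀ α : Abelian.Ext.{v} Y X 1, α = 0) (k : C ⟶ X) : ∃ l : P ⟶ X, f ≫ l = k := by
  obtain ⟨w, h⟩ := h
  obtain ⟨β, hβ⟩ := Abelian.Ext.contravariant_sequence_exact₁ h X (Abelian.Ext.mk₀ k)
    (n₁ := 1) rfl (hY _)
  obtain ⟨l, rfl⟩ := (Abelian.Ext.mk₀_bijective _ _).2 β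
  refine ⟨l, (Abelian.Ext.mk₀_bijective _ _).1 ?_⟩
  simpa using hβ

end Stmt2Aux

open ZeroObject in
/-- Proposition 3.6, (1) ⇒ (2), abelian version. -/
theorem stmt2 [EnoughProjectives A] [EnoughInjectives A]
    (𝒳 𝒲 : Set A) (hX : ExtClosed 𝒳) (hgen : IsGen 𝒲 𝒳) (hproj : IsXProj 𝒲 𝒳)
    (hW0 : (0 : A) ∈ 𝒲)
    (hWiso : ∀ ⦃X Y : A⦄, (X ≅ Y) → X ∈ 𝒲 → Y ∈ 𝒲)
    (C : A) (n : ℕ) (hC : HasCoresLE 𝒳 n C) :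
    ∃ (XC YC : A) (f : C ⟶ XC) (g : XC ⟶ YC),
      XC ∈ 𝒳 ∧ IsSES f g ∧ (∃ m ≤ n - 1, HasCoresLE 𝒲 m YC) ∧
      (∀ X' ∈ 𝒳, ∀ h : C ⟶ X', ∃ k : XC ⟶ X', f ≫ k = h) := by
  have : HasExt.{v} A := hasExt_of_enoughProjectives.{v} A
  cases n with
  | zero =>
    refine ⟨C, 0, 𝟙 C, 0, hC, Stmt2Aux.isSES_of_lift _ _ (by simp) fun k _ => ⟨k, by simp⟩,
      ⟨0, le_rfl, hW0⟩, fun X' _ h => ⟨h, by simp⟩⟩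
  | succ n =>
    obtain ⟨X, K, f, g, hx, h, hK⟩ := hC
    obtain ⟨X', Y, f', g', hx', hY, h'⟩ := Stmt2Aux.exists_precover hX hgen n K hK
    obtain ⟨P, i, q, hP, hiq⟩ := Stmt2Aux.step hX h h' hx hx'
    exact ⟨P, Y, i, q, hP, hiq, ⟨n, by simp, hY⟩, fun X' hX' k =>
      Stmt2Aux.extend hiq (Stmt2Aux.ext_cores hproj hX' n Y hY 1 le_rfl) k⟩
end

section
/- Let 𝒜 be an abelian category, 𝒳 an extension-closed full subcategory, and 𝒲 ⊆ 𝒳 an 𝒳-projective generator for 𝒳. If C has 𝒳-coresolution dimension at most n, then there exists a short exact sequence 0 → X_C → Y_C → C → 0 with X_C ∈ 𝒳 and Y_C having a 𝒲-coresolution of length at most n; moreover Y_C → C is a right approximation of C by objects with finite 𝒲-coresolution. -/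
open CategoryTheory CategoryTheory.Limits Opposite

universe v u

variable {A : Type u} [Category.{v} A] [Abelian A]

theorem isSES_of_lift {X Y Z : A} {f : X ⟶ Y} {g : Y ⟶ Z} (w : f ≫ g = 0) (hf : Mono f)
    (hg : Epi g) (h : ∀ (T : A) (t : T ⟶ Y), t ≫ g = 0 → ∃ s : T ⟶ X, s ≫ f = t) :
    IsSES f g := by
  refine ⟨w, ?_⟩
  have hl : IsLimit (KernelFork.ofι f w) :=
    KernelFork.IsLimit.ofι' f w (fun {T} t ht => ⟨(h T t ht).choose, (h T t ht).choose_spec⟩)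
  exact { exact := ShortComplex.exact_of_f_is_kernel _ hl, mono_f := hf, epi_g := hg }

theorem IsSES.lift {X Y Z : A} {f : X ⟶ Y} {g : Y ⟶ Z} (h : IsSES f g) {T : A} (t : T ⟶ Y)
    (ht : t ≫ g = 0) : ∃ s : T ⟶ X, s ≫ f = t := by
  obtain ⟨w, h⟩ := h
  have := h.mono_f
  exact ⟨h.exact.lift t ht, h.exact.lift_f t ht⟩

theorem IsSES.mono {X Y Z : A} {f : X ⟶ Y} {g : Y ⟶ Z} (h : IsSES f g) : Mono f := h.2.mono_f

theorem IsSES.epi {X Y Z : A} {f : X ⟶ Y} {g : Y ⟶ Z} (h : IsSES f g) : Epi g := h.2.epi_g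

theorem IsSES.pullback_fst {P Y K X : A} {p : P ⟶ Y} {q : Y ⟶ K} (h : IsSES p q) (b : X ⟶ K) :
    IsSES (pullback.lift (f := b) (g := q) 0 p (by simp [h.1])) (pullback.fst b q) := by
  have := h.mono
  have := h.epi
  refine isSES_of_lift (pullback.lift_fst _ _ _) ?_ inferInstance ?_
  · have : Mono (pullback.lift (f := b) (g := q) 0 p (by simp [h.1]) ≫ pullback.snd b q) := by
      rw [pullback.lift_snd]; infer_instance
    exact mono_of_mono _ (pullback.snd b q)
  · intro T t ht
    obtain ⟨s, hs⟩ := h.lift (t ≫ pullback.snd b q) (by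
      rw [Category.assoc, ← pullback.condition, reassoc_of% ht, zero_comp])
    refine ⟨s, pullback.hom_ext ?_ ?_⟩
    · rw [Category.assoc, pullback.lift_fst, ht, comp_zero]
    · rw [Category.assoc, pullback.lift_snd, hs]

theorem IsSES.pullback_snd {P Y K X : A} {p : P ⟶ Y} {q : Y ⟶ K} (h : IsSES p q) (b : X ⟶ K) :
    IsSES (pullback.lift (f := q) (g := b) p 0 (by simp [h.1])) (pullback.snd q b) := by
  have := h.mono
  have := h.epi
  refine isSES_of_lift (pullback.lift_snd _ _ _) ?_ inferInstance ?_
  · have : Mono (pullback.lift (f := q) (g := b) p 0 (by simp [h.1]) ≫ pullback.fst q b) := by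
      rw [pullback.lift_fst]; infer_instance
    exact mono_of_mono _ (pullback.fst q b)
  · intro T t ht
    obtain ⟨s, hs⟩ := h.lift (t ≫ pullback.fst q b) (by
      rw [Category.assoc, pullback.condition, reassoc_of% ht, zero_comp])
    refine ⟨s, pullback.hom_ext ?_ ?_⟩
    · rw [Category.assoc, pullback.lift_fst, hs]
    · rw [Category.assoc, pullback.lift_snd, ht, comp_zero]

theorem IsSES.pullback_comp {C E Y W : A} {j : C ⟶ E} {g : E ⟶ Y} (h : IsSES j g) (s : W ⟶ E)
    [Epi s] : IsSES (pullback.fst s j) (s ≫ g) := by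
  have := h.mono
  have := h.epi
  refine isSES_of_lift ?_ inferInstance inferInstance ?_
  · rw [← Category.assoc, pullback.condition, Category.assoc, h.1, comp_zero]
  · intro T t ht
    obtain ⟨u, hu⟩ := h.lift (t ≫ s) (by simpa using ht)
    exact ⟨pullback.lift t u hu.symm, pullback.lift_fst _ _ _⟩

universe w

theorem ext_eq_zero_of_extVanish [EnoughProjectives A] [HasExt.{w} A] {X Y : A} {i : ℕ}
    (hi : 1 ≤ i) (h : ExtVanish i X Y) (α : Abelian.Ext X Y i) : α = 0 := by
  obtain ⟨p, rfl⟩ : ∃ p, i = p + 1 := ⟨i - 1, by omega⟩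
  let R := projectiveResolution X
  obtain ⟨f, hf, rfl⟩ := R.extMk_surjective α (p + 2) rfl
  rw [R.extMk_eq_zero_iff f _ rfl hf p rfl]
  have h1 := h.of_iso (R.isoExt (R := ℤ) (p + 1) Y).symm
  rw [← HomologicalComplex.exactAt_iff_isZero_homology,
    HomologicalComplex.exactAt_iff' _ p (p + 1) (p + 2) (by simp) (by simp),
    ShortComplex.moduleCat_exact_iff] at h1
  obtain ⟨g, hg⟩ := h1 f hf
  exact ⟨g, hg⟩

theorem ext_cores_eq_zero [EnoughProjectives A] [HasExt.{w} A] {𝒳 𝒲 : Set A}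
    (hproj : IsXProj 𝒲 𝒳) {X : A} (hX : X ∈ 𝒳) (m : ℕ) :
    ∀ (Y : A), HasCoresLE 𝒲 m Y → ∀ (i : ℕ), 1 ≤ i → ∀ α : Abelian.Ext Y X i, α = 0 := by
  induction m with
  | zero => intro Y hY i hi α; exact ext_eq_zero_of_extVanish hi (hproj Y hY X hX i hi) α
  | succ m ih =>
    rintro Y ⟨W, K, f, g, hW, ⟨w, hS⟩, hK⟩ i hi α
    obtain ⟨β, hβ⟩ := Abelian.Ext.contravariant_sequence_exact₁ hS X α rfl
      (ih K hK _ (by omega) _)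
    rw [← hβ, ext_eq_zero_of_extVanish hi (hproj W hW X hX i hi) β, Abelian.Ext.comp_zero]

theorem exists_approx {𝒳 𝒲 : Set A} (hX : ExtClosed 𝒳) (hgen : IsGen 𝒲 𝒳) (n : ℕ) :
    ∀ C : A, HasCoresLE 𝒳 n C → ∃ (XC YC : A) (f : XC ⟶ YC) (g : YC ⟶ C),
      XC ∈ 𝒳 ∧ IsSES f g ∧ HasCoresLE 𝒲 n YC := by
  induction n with
  | zero =>
    intro C hC
    obtain ⟨X', W, f, g, hW, hX', h⟩ := hgen.2 C hC
    exact ⟨X', W, f, g, hX', h, hW⟩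
  | succ n ih =>
    rintro C ⟨X0, K, a, b, hX0, hab, hK⟩
    obtain ⟨XK, YK, p, q, hXK, hpq, hYK⟩ := ih K hK
    have hE : pullback b q ∈ 𝒳 := hX _ _ (hpq.pullback_fst b) hXK hX0
    obtain ⟨X', W, r, s, hW, hX', hrs⟩ := hgen.2 _ hE
    have := hrs.epi
    exact ⟨X', _, _, _, hX', hrs.pullback_snd _, W, YK, _, _, hW,
      (hab.pullback_snd q).pullback_comp s, hYK⟩

/-- Proposition 3.6, (1) ⇒ (3), abelian version. -/
theorem stmt3 [EnoughProjectives A] [EnoughInjectives A]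
    (𝒳 𝒲 : Set A) (hX : ExtClosed 𝒳) (hgen : IsGen 𝒲 𝒳) (hproj : IsXProj 𝒲 𝒳)
    (C : A) (n : ℕ) (hC : HasCoresLE 𝒳 n C) :
    ∃ (XC YC : A) (f : XC ⟶ YC) (g : YC ⟶ C),
      XC ∈ 𝒳 ∧ IsSES f g ∧ (∃ m ≤ n, HasCoresLE 𝒲 m YC) ∧
      (∀ Y' : A, (∃ m, HasCoresLE 𝒲 m Y') → ∀ h : Y' ⟶ C, ∃ k : Y' ⟶ YC, k ≫ g = h) := by
  obtain ⟨XC, YC, f, g, hXC, hfg, hYC⟩ := exists_approx hX hgen n C hC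
  refine ⟨XC, YC, f, g, hXC, hfg, ⟨n, le_rfl, hYC⟩, ?_⟩
  rintro Y' ⟨m, hY'⟩ h
  have := HasExt.standard A
  obtain ⟨w, hS⟩ := hfg
  obtain ⟨β, hβ⟩ := Abelian.Ext.covariant_sequence_exact₃ Y' hS (Abelian.Ext.mk₀ h) rfl
    (ext_cores_eq_zero hproj hXC m Y' hY' _ (by omega) _)
  obtain ⟨k, rfl⟩ := (Abelian.Ext.mk₀_bijective _ _).2 β
  refine ⟨k, (Abelian.Ext.mk₀_bijective _ _).1 ?_⟩
  rw [← hβ, Abelian.Ext.mk₀_comp_mk₀]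
end

section
/- Let 𝒜 be an abelian category, 𝒳 extension-closed, and 𝒲 an 𝒳-projective generator for 𝒳. Then 𝒲̌ = 𝒳̌ ∩ ⊥𝒳, i.e., an object has a finite 𝒲-coresolution if and only if it has a finite 𝒳-coresolution and Extⁱ(−, 𝒳) vanishes on it for all i ≥ 1. -/
open CategoryTheory CategoryTheory.Limits Opposite

universe v u

variable {A : Type u} [Category.{v} A] [Abelian A]

theorem extVanish_iff [EnoughProjectives A] [HasExt.{v} A] (n : ℕ) (X Y : A) :
    ExtVanish (n + 1) X Y ↔ ∀ x : Abelian.Ext.{v} X Y (n + 1), x = 0 := by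
  let P := projectiveResolution X
  have h1 : ExtVanish (n + 1) X Y ↔
      ∀ f : P.complex.X (n + 1) ⟶ Y, P.complex.d (n + 2) (n + 1) ≫ f = 0 →
        ∃ g : P.complex.X n ⟶ Y, P.complex.d (n + 1) n ≫ g = f := by
    unfold ExtVanish
    rw [(P.isoExt (R := ℤ) (n + 1) Y).isZero_iff,
      ← HomologicalComplex.exactAt_iff_isZero_homology,
      HomologicalComplex.exactAt_iff' _ n (n + 1) (n + 2) (by simp) (by simp),
      ShortComplex.moduleCat_exact_iff]
    rfl
  rw [h1]
  constructor
  · intro h x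
    obtain ⟨f, hf, rfl⟩ := P.extMk_surjective x (n + 2) rfl
    rw [P.extMk_eq_zero_iff _ _ _ _ n rfl]
    exact h f hf
  · intro h f hf
    exact (P.extMk_eq_zero_iff f (n + 2) rfl hf n rfl).1 (h _)

theorem isSES_pullback {X Y Z T P : A} {f : X ⟶ Y} {g : Y ⟶ Z} {p : P ⟶ Y} {q : P ⟶ T}
    {h : T ⟶ Z} (hp : IsPullback p q g h) (hS : IsSES f g) : ∃ f' : X ⟶ P, IsSES f' q := by
  obtain ⟨w, hS⟩ := hS
  have : Epi g := hS.epi_g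
  have : Mono f := hS.mono_f
  have hw : hp.lift f 0 (by simp [w]) ≫ q = 0 := by simp
  have : Epi q := Abelian.epi_snd_of_isLimit g h hp.isLimit
  have hm : Mono (hp.lift f 0 (by simp [w])) := by
    have : Mono (hp.lift f 0 (by simp [w]) ≫ p) := by simpa
    exact mono_of_mono _ p
  refine ⟨hp.lift f 0 (by simp [w]), hw, ?_⟩
  refine ShortComplex.ShortExact.mk' (ShortComplex.exact_of_f_is_kernel _
    (KernelFork.IsLimit.ofι' _ _ fun k hk => ?_)) hm this
  have hk' : k ≫ q = 0 := hk
  refine ⟨hS.exact.lift (k ≫ p) (by simp [hp.w, reassoc_of% hk']), ?_⟩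
  apply hp.hom_ext
  · simpa using hS.exact.lift_f (k ≫ p) _
  · simp [hk']

theorem isSES_comp {C P K W Q : A} {c : C ⟶ P} {d : P ⟶ K} {p : Q ⟶ W} {q : Q ⟶ C}
    {v : W ⟶ P} [Epi v] (hp : IsPullback p q v c) (hS : IsSES c d) : IsSES p (v ≫ d) := by
  obtain ⟨w, hS⟩ := hS
  have : Epi d := hS.epi_g
  have : Mono c := hS.mono_f
  have hm : Mono p := ⟨fun x y hxy => hp.hom_ext hxy (by
    rw [← cancel_mono c, Category.assoc, Category.assoc, ← hp.w, reassoc_of% hxy])⟩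
  have he : Epi (v ≫ d) := epi_comp _ _
  refine ⟨by rw [hp.w_assoc, w, comp_zero], ?_⟩
  refine ShortComplex.ShortExact.mk' (ShortComplex.exact_of_f_is_kernel _
    (KernelFork.IsLimit.ofι' _ _ fun k hk => ?_)) hm he
  have hk' : (k ≫ v) ≫ d = 0 := by simpa using hk
  exact ⟨hp.lift k (hS.exact.lift (k ≫ v) hk') (hS.exact.lift_f _ hk').symm, by simp⟩

theorem approx_step {𝒳 𝒲 : Set A} (hX : ExtClosed 𝒳) {n : ℕ} {C X K X' Y' : A}
    {f : C ⟶ X} {g : X ⟶ K} {a : X' ⟶ Y'} {b : Y' ⟶ K} (hXm : X ∈ 𝒳) (hfg : IsSES f g)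
    (hX' : X' ∈ 𝒳) (hab : IsSES a b) (hY' : HasCoresLE 𝒲 n Y') :
    ∃ (P Y : A) (c : C ⟶ P) (d : P ⟶ Y), P ∈ 𝒳 ∧ IsSES c d ∧ HasCoresLE 𝒲 n Y := by
  have hp := IsPullback.of_hasPullback g b
  obtain ⟨c, hc⟩ := isSES_pullback hp hfg
  obtain ⟨e, he⟩ := isSES_pullback hp.flip hab
  exact ⟨_, Y', c, _, hX _ _ he hX' hXm, hc, hY'⟩

theorem approx {𝒳 𝒲 : Set A} (hX : ExtClosed 𝒳) (hgen : IsGen 𝒲 𝒳) (n : ℕ) :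
    ∀ C : A, HasCoresLE 𝒳 n C → ∃ (X' Y' : A) (a : X' ⟶ Y') (b : Y' ⟶ C),
      X' ∈ 𝒳 ∧ IsSES a b ∧ HasCoresLE 𝒲 n Y' := by
  induction n with
  | zero =>
    intro C hC
    obtain ⟨X', W, f, g, hW, hX', h⟩ := hgen.2 C hC
    exact ⟨X', W, f, g, hX', h, hW⟩
  | succ n ih =>
    rintro C ⟨X, K, f, g, hXm, hfg, hK⟩
    obtain ⟨X', Y', a, b, hX', hab, hY'⟩ := ih K hK
    obtain ⟨P, Y, c, d, hP, hcd, hY⟩ := approx_step hX hXm hfg hX' hab hY'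
    obtain ⟨X'', W, s, v, hW, hX'', h⟩ := hgen.2 P hP
    have hp := IsPullback.of_hasPullback v c
    obtain ⟨e, he⟩ := isSES_pullback hp h
    have : Epi v := h.2.epi_g
    exact ⟨X'', _, e, _, hX'', he, W, Y, _, _, hW, isSES_comp hp hcd, hY⟩

theorem perp_left [EnoughProjectives A] {X Y K Z : A} {f : Y ⟶ X} {g : X ⟶ K} (h : IsSES f g)
    (h1 : ∀ i : ℕ, 1 ≤ i → ExtVanish i X Z) (h2 : ∀ i : ℕ, 1 ≤ i → ExtVanish i K Z) :
    ∀ i : ℕ, 1 ≤ i → ExtVanish i Y Z := by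
  have := hasExt_of_enoughProjectives.{v} A
  obtain ⟨w, hS⟩ := h
  intro i hi
  obtain ⟨n, rfl⟩ : ∃ n, i = n + 1 := ⟨i - 1, by omega⟩
  rw [extVanish_iff]
  intro x
  obtain ⟨y, hy⟩ := Abelian.Ext.contravariant_sequence_exact₁ hS Z x (n₁ := n + 1 + 1) (by omega)
    ((extVanish_iff _ _ _).1 (h2 _ (by omega)) _)
  rw [← hy, (extVanish_iff _ _ _).1 (h1 _ hi) y, Abelian.Ext.comp_zero]

theorem perp_mid [EnoughProjectives A] {X Y K Z : A} {f : Y ⟶ X} {g : X ⟶ K} (h : IsSES f g)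
    (h1 : ∀ i : ℕ, 1 ≤ i → ExtVanish i Y Z) (h2 : ∀ i : ℕ, 1 ≤ i → ExtVanish i K Z) :
    ∀ i : ℕ, 1 ≤ i → ExtVanish i X Z := by
  have := hasExt_of_enoughProjectives.{v} A
  obtain ⟨w, hS⟩ := h
  intro i hi
  obtain ⟨n, rfl⟩ : ∃ n, i = n + 1 := ⟨i - 1, by omega⟩
  rw [extVanish_iff]
  intro x
  obtain ⟨y, hy⟩ := Abelian.Ext.contravariant_sequence_exact₂ hS Z x
    ((extVanish_iff _ _ _).1 (h1 _ hi) _)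
  rw [← hy, (extVanish_iff _ _ _).1 (h2 _ hi) y, Abelian.Ext.comp_zero]

theorem split_of_vanish [EnoughProjectives A] {X Y K : A} {f : Y ⟶ X} {g : X ⟶ K}
    (h : IsSES f g) (h1 : ExtVanish 1 K Y) : ∃ s : K ⟶ X, s ≫ g = 𝟙 K := by
  have := hasExt_of_enoughProjectives.{v} A
  obtain ⟨w, hS⟩ := h
  obtain ⟨y, hy⟩ := Abelian.Ext.covariant_sequence_exact₃ K hS (Abelian.Ext.mk₀ (𝟙 K))
    (n₁ := 1) (by omega) ((extVanish_iff 0 _ _).1 h1 _)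
  obtain ⟨s, rfl⟩ := Abelian.Ext.addEquiv₀.symm.surjective y
  refine ⟨s, ?_⟩
  apply (Abelian.Ext.mk₀_bijective K K).1
  simpa [Abelian.Ext.addEquiv₀, Abelian.Ext.mk₀_comp_mk₀] using hy

theorem perp_of_cores [EnoughProjectives A] {𝒳 𝒲 : Set A} (hproj : IsXProj 𝒲 𝒳) (n : ℕ) :
    ∀ Y : A, HasCoresLE 𝒲 n Y → ∀ Z ∈ 𝒳, ∀ i : ℕ, 1 ≤ i → ExtVanish i Y Z := by
  induction n with
  | zero => exact fun Y hY Z hZ => hproj Y hY Z hZ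
  | succ n ih =>
    rintro Y ⟨X, K, f, g, hXm, hfg, hK⟩ Z hZ
    exact perp_left hfg (hproj X hXm Z hZ) (ih K hK Z hZ)

theorem cores_mono {𝒳 𝒲 : Set A} (h : 𝒲 ⊆ 𝒳) (n : ℕ) :
    ∀ Y : A, HasCoresLE 𝒲 n Y → HasCoresLE 𝒳 n Y := by
  induction n with
  | zero => exact fun Y hY => h hY
  | succ n ih =>
    rintro Y ⟨X, K, f, g, hXm, hfg, hK⟩
    exact ⟨X, K, f, g, h hXm, hfg, ih K hK⟩

/-- Proposition 4.2(3), abelian version. -/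
theorem stmt9 [EnoughProjectives A] [EnoughInjectives A]
    (𝒳 𝒲 : Set A) (hX : ExtClosed 𝒳) (hgen : IsGen 𝒲 𝒳) (hproj : IsXProj 𝒲 𝒳)
    (hWiso : ∀ ⦃X Y : A⦄, (X ≅ Y) → X ∈ 𝒲 → Y ∈ 𝒲)
    (hWretract : ∀ ⦃X Y : A⦄ (r : X ⟶ Y) (s : Y ⟶ X), s ≫ r = 𝟙 Y → X ∈ 𝒲 → Y ∈ 𝒲) :
    {Y : A | ∃ n, HasCoresLE 𝒲 n Y} =
      {Y : A | ∃ n, HasCoresLE 𝒳 n Y} ∩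
        {Y : A | ∀ i : ℕ, 1 ≤ i → ∀ Z ∈ 𝒳, ExtVanish i Y Z} := by
  have key : ∀ Y ∈ 𝒳, (∀ i : ℕ, 1 ≤ i → ∀ Z ∈ 𝒳, ExtVanish i Y Z) → Y ∈ 𝒲 := by
    intro Y hY hv
    obtain ⟨X', W, f, g, hW, hX', h⟩ := hgen.2 Y hY
    obtain ⟨s, hs⟩ := split_of_vanish h (hv 1 le_rfl X' hX')
    exact hWretract g s hs hW
  ext Y
  constructor
  · rintro ⟨n, hn⟩
    exact ⟨⟨n, cores_mono hgen.1 n Y hn⟩, fun i hi Z hZ => perp_of_cores hproj n Y hn Z hZ i hi⟩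
  · rintro ⟨⟨n, hn⟩, hv⟩
    cases n with
    | zero => exact ⟨0, key Y hn hv⟩
    | succ n =>
      obtain ⟨X, K, f, g, hXm, hfg, hK⟩ := hn
      obtain ⟨X', Y', a, b, hX', hab, hY'⟩ := approx hX hgen n K hK
      obtain ⟨P, L, c, d, hP, hcd, hL⟩ := approx_step hX hXm hfg hX' hab hY'
      refine ⟨n + 1, P, L, c, d, key P hP ?_, hcd, hL⟩
      exact fun i hi Z hZ => perp_mid hcd (fun j hj => hv j hj Z hZ)
        (perp_of_cores hproj n L hL Z hZ) i hi
end

section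
/- Let 𝒜 be an abelian category with enough projectives and injectives, and let (𝒰, 𝒱) be a complete cotorsion pair on 𝒜 (Ext¹(𝒰, 𝒱) = 0, each object admits a special 𝒱-preenvelope with cokernel in 𝒰 and a special 𝒰-precover with kernel in 𝒱). Then the following are equivalent: (1) 𝒰 is resolving (contains the projectives, closed under extensions and kernels of epimorphisms); (2) 𝒱 is coresolving (contains the injectives, closed under extensions and cokernels of monomorphisms); (3) Extⁱ(U, V) = 0 for all U ∈ 𝒰, V ∈ 𝒱 and all i ≥ 1. -/
open CategoryTheory CategoryTheory.Limits Opposite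

universe v u

variable {A : Type u} [Category.{v} A] [Abelian A]

lemma bridge [EnoughProjectives A] [HasExt.{v} A] (n : ℕ) (X Y : A) :
    ExtVanish (n+1) X Y ↔ Subsingleton (Abelian.Ext X Y (n+1)) := by
  let P := ProjectiveResolution.of X
  have h1 : ExtVanish (n+1) X Y ↔ ∀ f : P.complex.X (n+1) ⟶ Y, P.complex.d (n+2) (n+1) ≫ f = 0 →
      ∃ g : P.complex.X n ⟶ Y, P.complex.d (n+1) n ≫ g = f := by
    unfold ExtVanish
    rw [(P.isoExt (R := ℤ) (n+1) Y).isZero_iff, ← HomologicalComplex.exactAt_iff_isZero_homology,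
      HomologicalComplex.exactAt_iff' _ n (n+1) (n+2) (by simp) (by simp),
      ShortComplex.moduleCat_exact_iff]
    exact Iff.rfl
  rw [h1]
  constructor
  · intro h
    refine ⟨fun a b => ?_⟩
    have key : ∀ a : Abelian.Ext X Y (n+1), a = 0 := by
      intro a
      obtain ⟨f, hf, rfl⟩ := P.extMk_surjective a (n+2) rfl
      rw [P.extMk_eq_zero_iff f (n+2) rfl hf n rfl]
      exact h f hf
    rw [key a, key b]
  · intro h f hf
    exact (P.extMk_eq_zero_iff f (n+2) rfl hf n rfl).1 (Subsingleton.elim _ _)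

section core
variable [HasExt.{v} A]

lemma contra_X₁ {X Y Z V : A} {f : X ⟶ Y} {g : Y ⟶ Z} (h : IsSES f g) (n : ℕ)
    (h2 : Subsingleton (Abelian.Ext Y V n)) (h3 : Subsingleton (Abelian.Ext Z V (n+1))) :
    Subsingleton (Abelian.Ext X V n) := by
  obtain ⟨w, hS⟩ := h
  refine subsingleton_of_forall_eq 0 fun x => ?_
  obtain ⟨y, rfl⟩ := Abelian.Ext.contravariant_sequence_exact₁ hS V x (n₁ := n+1) (by omega)
    (@Subsingleton.elim _ h3 _ _)
  rw [@Subsingleton.elim _ h2 y 0, Abelian.Ext.comp_zero]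

lemma contra_X₂ {X Y Z V : A} {f : X ⟶ Y} {g : Y ⟶ Z} (h : IsSES f g) (n : ℕ)
    (h1 : Subsingleton (Abelian.Ext X V n)) (h3 : Subsingleton (Abelian.Ext Z V n)) :
    Subsingleton (Abelian.Ext Y V n) := by
  obtain ⟨w, hS⟩ := h
  refine subsingleton_of_forall_eq 0 fun x => ?_
  obtain ⟨y, rfl⟩ := Abelian.Ext.contravariant_sequence_exact₂ hS V x
    (@Subsingleton.elim _ h1 _ _)
  rw [@Subsingleton.elim _ h3 y 0, Abelian.Ext.comp_zero]

lemma contra_X₃ {X Y Z V : A} {f : X ⟶ Y} {g : Y ⟶ Z} (h : IsSES f g) (n : ℕ)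
    (h1 : Subsingleton (Abelian.Ext X V n)) (h2 : Subsingleton (Abelian.Ext Y V (n+1))) :
    Subsingleton (Abelian.Ext Z V (n+1)) := by
  obtain ⟨w, hS⟩ := h
  refine subsingleton_of_forall_eq 0 fun x => ?_
  obtain ⟨y, rfl⟩ := Abelian.Ext.contravariant_sequence_exact₃ hS V x
    (@Subsingleton.elim _ h2 _ _) (n₀ := n) (by omega)
  rw [@Subsingleton.elim _ h1 y 0, Abelian.Ext.comp_zero]

lemma co_X₃ {X Y Z U : A} {f : X ⟶ Y} {g : Y ⟶ Z} (h : IsSES f g) (n : ℕ)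
    (h2 : Subsingleton (Abelian.Ext U Y n)) (h1 : Subsingleton (Abelian.Ext U X (n+1))) :
    Subsingleton (Abelian.Ext U Z n) := by
  obtain ⟨w, hS⟩ := h
  refine subsingleton_of_forall_eq 0 fun x => ?_
  obtain ⟨y, rfl⟩ := Abelian.Ext.covariant_sequence_exact₃ U hS x (n₁ := n+1) rfl
    (@Subsingleton.elim _ h1 _ _)
  rw [@Subsingleton.elim _ h2 y 0, Abelian.Ext.zero_comp]

lemma co_X₂ {X Y Z U : A} {f : X ⟶ Y} {g : Y ⟶ Z} (h : IsSES f g) (n : ℕ)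
    (h1 : Subsingleton (Abelian.Ext U X n)) (h3 : Subsingleton (Abelian.Ext U Z n)) :
    Subsingleton (Abelian.Ext U Y n) := by
  obtain ⟨w, hS⟩ := h
  refine subsingleton_of_forall_eq 0 fun x => ?_
  obtain ⟨y, rfl⟩ := Abelian.Ext.covariant_sequence_exact₂ U hS x
    (@Subsingleton.elim _ h3 _ _)
  rw [@Subsingleton.elim _ h1 y 0, Abelian.Ext.zero_comp]

lemma co_X₁ {X Y Z U : A} {f : X ⟶ Y} {g : Y ⟶ Z} (h : IsSES f g) (n : ℕ)
    (h3 : Subsingleton (Abelian.Ext U Z n)) (h2 : Subsingleton (Abelian.Ext U Y (n+1))) :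
    Subsingleton (Abelian.Ext U X (n+1)) := by
  obtain ⟨w, hS⟩ := h
  refine subsingleton_of_forall_eq 0 fun x => ?_
  obtain ⟨y, rfl⟩ := Abelian.Ext.covariant_sequence_exact₁ U hS x
    (@Subsingleton.elim _ h2 _ _) (n₀ := n) rfl
  rw [@Subsingleton.elim _ h3 y 0, Abelian.Ext.zero_comp]

lemma split_section {X Y Z : A} {f : X ⟶ Y} {g : Y ⟶ Z} (h : IsSES f g)
    (h1 : Subsingleton (Abelian.Ext Z X 1)) : ∃ s : Z ⟶ Y, s ≫ g = 𝟙 Z := by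
  obtain ⟨w, hS⟩ := h
  obtain ⟨y, hy⟩ := Abelian.Ext.covariant_sequence_exact₃ Z hS (Abelian.Ext.mk₀ (𝟙 Z))
    (n₁ := 1) rfl (@Subsingleton.elim _ h1 _ _)
  obtain ⟨s, rfl⟩ := (Abelian.Ext.mk₀_bijective _ _).2 y
  rw [Abelian.Ext.mk₀_comp_mk₀] at hy
  exact ⟨s, (Abelian.Ext.mk₀_bijective _ _).1 hy⟩

lemma split_retraction {X Y Z : A} {f : X ⟶ Y} {g : Y ⟶ Z} (h : IsSES f g)
    (h1 : Subsingleton (Abelian.Ext Z X 1)) : ∃ r : Y ⟶ X, f ≫ r = 𝟙 X := by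
  obtain ⟨w, hS⟩ := h
  obtain ⟨y, hy⟩ := Abelian.Ext.contravariant_sequence_exact₁ hS X (Abelian.Ext.mk₀ (𝟙 X))
    (n₁ := 1) rfl (@Subsingleton.elim _ h1 _ _)
  obtain ⟨s, rfl⟩ := (Abelian.Ext.mk₀_bijective _ _).2 y
  rw [Abelian.Ext.mk₀_comp_mk₀] at hy
  exact ⟨s, (Abelian.Ext.mk₀_bijective _ _).1 hy⟩

end core

lemma exists_proj_ses [EnoughProjectives A] (X : A) :
    ∃ (K P : A) (f : K ⟶ P) (g : P ⟶ X), Projective P ∧ IsSES f g :=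
  ⟨kernel (Projective.π X), Projective.over X, kernel.ι _, Projective.π X, inferInstance,
    kernel.condition _,
    { exact := ShortComplex.exact_of_f_is_kernel _ (kernelIsKernel _)
      mono_f := by dsimp; infer_instance
      epi_g := by dsimp; infer_instance }⟩

lemma exists_inj_ses [EnoughInjectives A] (X : A) :
    ∃ (I K : A) (f : X ⟶ I) (g : I ⟶ K), Injective I ∧ IsSES f g :=
  ⟨Injective.under X, cokernel (Injective.ι X), Injective.ι X, cokernel.π _, inferInstance,
    cokernel.condition _,
    { exact := ShortComplex.exact_of_g_is_cokernel _ (cokernelIsCokernel _)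
      mono_f := by dsimp; infer_instance
      epi_g := by dsimp; infer_instance }⟩


/-- Lemma 4.5, abelian version. -/
theorem stmt11 [EnoughProjectives A] [EnoughInjectives A]
    (𝒰 𝒱 : Set A)
    (horth : ∀ U ∈ 𝒰, ∀ V ∈ 𝒱, ExtVanish 1 U V)
    (henv : ∀ C : A, ∃ (V U : A) (f : C ⟶ V) (g : V ⟶ U), V ∈ 𝒱 ∧ U ∈ 𝒰 ∧ IsSES f g)
    (hcov : ∀ C : A, ∃ (V U : A) (f : V ⟶ U) (g : U ⟶ C), V ∈ 𝒱 ∧ U ∈ 𝒰 ∧ IsSES f g)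
    (hUiso : ∀ ⦃X Y : A⦄, (X ≅ Y) → X ∈ 𝒰 → Y ∈ 𝒰)
    (hViso : ∀ ⦃X Y : A⦄, (X ≅ Y) → X ∈ 𝒱 → Y ∈ 𝒱)
    (hUretract : ∀ ⦃X Y : A⦄ (r : X ⟶ Y) (s : Y ⟶ X), s ≫ r = 𝟙 Y → X ∈ 𝒰 → Y ∈ 𝒰)
    (hVretract : ∀ ⦃X Y : A⦄ (r : X ⟶ Y) (s : Y ⟶ X), s ≫ r = 𝟙 Y → X ∈ 𝒱 → Y ∈ 𝒱) :
    (((∀ P : A, Projective P → P ∈ 𝒰) ∧ ExtClosed 𝒰 ∧ KerClosed 𝒰) ↔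
      ((∀ I : A, Injective I → I ∈ 𝒱) ∧ ExtClosed 𝒱 ∧ CokerClosed 𝒱)) ∧
    (((∀ I : A, Injective I → I ∈ 𝒱) ∧ ExtClosed 𝒱 ∧ CokerClosed 𝒱) ↔
      (∀ U ∈ 𝒰, ∀ V ∈ 𝒱, ∀ i : ℕ, 1 ≤ i → ExtVanish i U V)) := by
  haveI : HasExt.{v} A := CategoryTheory.hasExt_of_enoughProjectives.{v} A
  have horth' : ∀ U ∈ 𝒰, ∀ V ∈ 𝒱, Subsingleton (Abelian.Ext U V 1) := fun U hU V hV =>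
    (bridge 0 U V).1 (horth U hU V hV)
  have memU : ∀ C : A, (∀ V ∈ 𝒱, Subsingleton (Abelian.Ext C V 1)) → C ∈ 𝒰 := by
    intro C hC
    obtain ⟨V, U, f, g, hV, hU, h⟩ := hcov C
    obtain ⟨s, hs⟩ := split_section h (hC V hV)
    exact hUretract g s hs hU
  have memV : ∀ C : A, (∀ U ∈ 𝒰, Subsingleton (Abelian.Ext U C 1)) → C ∈ 𝒱 := by
    intro C hC
    obtain ⟨V, U, f, g, hV, hU, h⟩ := henv C
    obtain ⟨r, hr⟩ := split_retraction h (hC U hU)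
    exact hVretract r f hr hV
  have projU : ∀ P : A, Projective P → P ∈ 𝒰 := fun P _ => memU P fun V _ =>
    Abelian.Ext.subsingleton_of_projective P V 0
  have injV : ∀ I : A, Injective I → I ∈ 𝒱 := fun I _ => memV I fun U _ =>
    Abelian.Ext.subsingleton_of_injective U I 0
  have extU : ExtClosed 𝒰 := fun X Y Z f g h hX hZ => memU Y fun V hV =>
    contra_X₂ h 1 (horth' X hX V hV) (horth' Z hZ V hV)
  have extV : ExtClosed 𝒱 := fun X Y Z f g h hX hZ => memV Y fun U hU =>
    co_X₂ h 1 (horth' U hU X hX) (horth' U hU Z hZ)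
  have h3iff : (∀ U ∈ 𝒰, ∀ V ∈ 𝒱, ∀ i : ℕ, 1 ≤ i → ExtVanish i U V) ↔
      ∀ n : ℕ, ∀ U ∈ 𝒰, ∀ V ∈ 𝒱, Subsingleton (Abelian.Ext U V (n+1)) := by
    constructor
    · intro h n U hU V hV
      exact (bridge n U V).1 (h U hU V hV (n+1) (by omega))
    · intro h U hU V hV i hi
      obtain ⟨n, rfl⟩ : ∃ n, i = n + 1 := ⟨i - 1, by omega⟩
      exact (bridge n U V).2 (h n U hU V hV)
  have h13 : KerClosed 𝒰 ↔ ∀ n : ℕ, ∀ U ∈ 𝒰, ∀ V ∈ 𝒱, Subsingleton (Abelian.Ext U V (n+1)) := by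
    constructor
    · intro hk n
      induction n with
      | zero => exact horth'
      | succ n ih =>
        intro U hU V hV
        obtain ⟨K, P, f, g, hP, h⟩ := exists_proj_ses U
        exact contra_X₃ h (n+1) (ih K (hk f g h (projU P hP) hU) V hV)
          (Abelian.Ext.subsingleton_of_projective P V (n+1))
    · intro h3 X Y Z f g h hY hZ
      exact memU X fun V hV => contra_X₁ h 1 (horth' Y hY V hV) (h3 1 Z hZ V hV)
  have h23 : CokerClosed 𝒱 ↔
      ∀ n : ℕ, ∀ U ∈ 𝒰, ∀ V ∈ 𝒱, Subsingleton (Abelian.Ext U V (n+1)) := by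
    constructor
    · intro hk n
      induction n with
      | zero => exact horth'
      | succ n ih =>
        intro U hU V hV
        obtain ⟨I, K, f, g, hI, h⟩ := exists_inj_ses V
        exact co_X₁ h (n+1) (ih U hU K (hk f g h hV (injV I hI)))
          (Abelian.Ext.subsingleton_of_injective U I (n+1))
    · intro h3 X Y Z f g h hX hY
      exact memV Z fun U hU => co_X₃ h 1 (horth' U hU Y hY) (h3 1 U hU X hX)
  rw [h3iff, ← h23]
  refine ⟨⟨fun h => ⟨injV, extV, h23.2 (h13.1 h.2.2)⟩, fun h => ⟨projU, extU, h13.2 (h23.1 h.2.2)⟩⟩,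
    fun h => h.2.2, fun h => ⟨injV, extV, h⟩⟩
end

section
/- Let 𝒜 be an abelian category with enough projectives and injectives and let ℋ be a full subcategory that is coresolving (contains injectives, closed under extensions and cokernels of monomorphisms) and specially covariantly finite (every object C fits in a short exact sequence 0 → C → H → K → 0 with H ∈ ℋ and Ext¹(K, ℋ) = 0). Then ℋ ∩ ⊥ℋ is an ℋ-projective generator for ℋ: every H ∈ ℋ admits a short exact sequence 0 → H' → M → H → 0 with M ∈ ℋ ∩ ⊥ℋ and H' ∈ ℋ. -/
open CategoryTheory CategoryTheory.Limits Opposite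

universe v u

variable {A : Type u} [Category.{v} A] [Abelian A]

lemma extVanish_iff_cocycles [EnoughProjectives A] {X : A} (P : ProjectiveResolution X) (Y : A)
    (n : ℕ) : ExtVanish (n + 1) X Y ↔ ∀ f : P.complex.X (n + 1) ⟶ Y,
      P.complex.d (n + 2) (n + 1) ≫ f = 0 →
        ∃ g : P.complex.X n ⟶ Y, P.complex.d (n + 1) n ≫ g = f := by
  unfold ExtVanish
  rw [(P.isoExt (R := ℤ) (n + 1) Y).isZero_iff, ← HomologicalComplex.exactAt_iff_isZero_homology,
    HomologicalComplex.exactAt_iff' _ n (n + 1) (n + 2) (by simp) (by simp),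
    ShortComplex.moduleCat_exact_iff]
  exact Iff.rfl

lemma extVanish_iff_subsingleton [EnoughProjectives A] [HasExt.{max u v} A] (X Y : A) (n : ℕ) :
    ExtVanish (n + 1) X Y ↔ Subsingleton (Abelian.Ext.{max u v} X Y (n + 1)) := by
  let P := ProjectiveResolution.of X
  rw [extVanish_iff_cocycles P]
  constructor
  · intro h
    refine subsingleton_of_forall_eq 0 fun α => ?_
    obtain ⟨f, hf, rfl⟩ := P.extMk_surjective α (n + 2) rfl
    exact (P.extMk_eq_zero_iff f (n + 2) rfl hf n rfl).2 (h f hf)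
  · intro h f hf
    exact (P.extMk_eq_zero_iff f (n + 2) rfl hf n rfl).1 (Subsingleton.elim _ _)

/-- Pushout of a short exact sequence along a map out of its left term. -/
lemma isSES_pushout {X Y Z X' : A} {f : X ⟶ Y} {g : Y ⟶ Z} (h : IsSES f g) (a : X ⟶ X') :
    ∃ q : pushout f a ⟶ Z, IsSES (pushout.inr f a) q := by
  obtain ⟨w, hS⟩ := h
  have : Mono f := hS.mono_f
  have : Epi g := hS.epi_g
  have e0 : f ≫ g = a ≫ (0 : X' ⟶ Z) := by rw [w, comp_zero]
  obtain ⟨q, hq1, hq2⟩ : ∃ q : pushout f a ⟶ Z, pushout.inl f a ≫ q = g ∧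
      pushout.inr f a ≫ q = 0 :=
    ⟨pushout.desc g 0 e0, pushout.inl_desc _ _ _, pushout.inr_desc _ _ _⟩
  refine ⟨q, hq2, ?_⟩
  have : Epi q := epi_of_epi_fac hq1
  refine { exact := ?_, mono_f := ?_, epi_g := this }
  · apply ShortComplex.exact_of_g_is_cokernel
    refine CokernelCofork.IsColimit.ofπ' _ _ fun {T} k hk => ?_
    dsimp at k hk
    have e : f ≫ pushout.inl f a ≫ k = 0 := by rw [pushout.condition_assoc, hk, comp_zero]
    refine ⟨hS.exact.desc (pushout.inl f a ≫ k) e, ?_⟩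
    apply pushout.hom_ext
    · simpa [reassoc_of% hq1] using hS.exact.g_desc _ e
    · simp [hk, reassoc_of% hq2]
  · dsimp; infer_instance

lemma IsSES.pushout_flip {X Y Y' K : A} {f : X ⟶ Y} {a : X ⟶ Y'} {b : Y' ⟶ K} (h : IsSES a b) :
    ∃ q : pushout f a ⟶ K, IsSES (pushout.inl f a) q := by
  obtain ⟨q, w, hS⟩ := isSES_pushout h f
  refine ⟨(pushoutSymmetry f a).hom ≫ q, by simp [w], ?_⟩
  refine ShortComplex.shortExact_of_iso (S₁ := ShortComplex.mk _ _ w)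
    (ShortComplex.isoMk (Iso.refl _)
      (pushoutSymmetry f a).symm (Iso.refl _) (by simp) (by simp)) hS

/-- Lemma 4.6, abelian version. -/
theorem stmt12 [EnoughProjectives A] [EnoughInjectives A]
    (ℋ : Set A)
    (hinj : ∀ I : A, Injective I → I ∈ ℋ) (hext : ExtClosed ℋ) (hcoker : CokerClosed ℋ)
    (hscf : ∀ C : A, ∃ (H K : A) (f : C ⟶ H) (g : H ⟶ K),
      H ∈ ℋ ∧ IsSES f g ∧ ∀ H' ∈ ℋ, ExtVanish 1 K H') :
    ∀ H ∈ ℋ, ∃ (H' M : A) (f : H' ⟶ M) (g : M ⟶ H),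
      M ∈ ℋ ∧ (∀ i : ℕ, 1 ≤ i → ∀ H'' ∈ ℋ, ExtVanish i M H'') ∧ H' ∈ ℋ ∧ IsSES f g := by
  intro H hH
  have := HasExt.standard A
  let p := Projective.π H
  have hp : IsSES (kernel.ι p) p :=
    ⟨kernel.condition p, { exact := ShortComplex.exact_kernel p, mono_f := inferInstance, epi_g := inferInstance }⟩
  obtain ⟨H', K, a, b, hH', hab, hK⟩ := hscf (kernel p)
  obtain ⟨q, hq⟩ := isSES_pushout hp a
  obtain ⟨r, hr⟩ := hab.pushout_flip (f := kernel.ι p)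
  refine ⟨H', pushout (kernel.ι p) a, pushout.inr _ _, q, hext _ _ hq hH' hH, ?_, hH', hq⟩
  have key : ∀ i : ℕ, ∀ H'' ∈ ℋ, ExtVanish (i + 1) (pushout (kernel.ι p) a) H'' := by
    intro i
    induction i with
    | zero =>
      intro H'' h''
      rw [extVanish_iff_subsingleton]
      have h1 := (extVanish_iff_subsingleton _ _ _).1 (hK H'' h'')
      refine subsingleton_of_forall_eq 0 fun x => ?_
      obtain ⟨w, hS⟩ := hr
      obtain ⟨y, rfl⟩ := Abelian.Ext.contravariant_sequence_exact₂ hS _ x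
        (Abelian.Ext.eq_zero_of_projective _)
      rw [Subsingleton.elim y 0, Abelian.Ext.comp_zero]
    | succ n ih =>
      intro H'' h''
      rw [extVanish_iff_subsingleton]
      let j := Injective.ι H''
      have hS : (ShortComplex.mk j (cokernel.π j) (cokernel.condition j)).ShortExact :=
        { exact := ShortComplex.exact_cokernel j, mono_f := inferInstanceAs (Mono (Injective.ι H'')), epi_g := inferInstanceAs (Epi (cokernel.π j)) }
      have hC : cokernel j ∈ ℋ := hcoker j (cokernel.π j) ⟨_, hS⟩ h'' (hinj _ inferInstance)
      have h1 := (extVanish_iff_subsingleton _ _ _).1 (ih _ hC)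
      refine subsingleton_of_forall_eq 0 fun x => ?_
      obtain ⟨y, rfl⟩ := Abelian.Ext.covariant_sequence_exact₁ _ hS x
        (Abelian.Ext.eq_zero_of_injective _) rfl
      rw [Subsingleton.elim y 0, Abelian.Ext.zero_comp]
  intro i hi H'' h''
  obtain ⟨n, rfl⟩ := Nat.exists_eq_add_of_le' hi
  exact key n H'' h''
end
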